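/- arXiv:1805.07878 — 3 statements merged into one kernel-verified Lean document; each statement's English description precedes it below -/
import Mathlib

section
/- Let G be a signed graph with a fixed orientation, let Γ be a finite additive abelian group of order k, and let F*(G,Γ) denote the number of Γ-flows in G (flows are not required to be nowhere-zero). Then F*(G,Γ) = 2^{κ(G)·ε(Γ)} · k^{β(G)}. -/
/-- A signed graph: each edge `e` has endpoints `a e`, `b e` (equal for a loop)
and a sign `sign e ∈ {1, -1}`. -/
structure SignedGraph (V E : Type) where
  a : E → V
  b : E → V
  sign : E → ℤ
  sign_unit : ∀ e, sign e = 1 ∨ sign e = -1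

namespace SignedGraph

variable {V E : Type}

/-- An orientation of a signed graph: incidence signs `ηa e`, `ηb e ∈ {1,-1}` at the
two ends of each edge, with `ηa e * ηb e = - sign e`. -/
structure Orientation (G : SignedGraph V E) where
  ηa : E → ℤ
  ηb : E → ℤ
  ηa_unit : ∀ e, ηa e = 1 ∨ ηa e = -1
  ηb_unit : ∀ e, ηb e = 1 ∨ ηb e = -1
  compat : ∀ e, ηa e * ηb e = - G.sign e

/-- Kirchhoff's law at every vertex: a `Γ`-flow. -/
def IsFlow [Fintype E] [DecidableEq V] {Γ : Type} [AddCommGroup Γ]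
    (G : SignedGraph V E) (O : G.Orientation) (f : E → Γ) : Prop :=
  ∀ v : V, ∑ e : E,
    ((if G.a e = v then O.ηa e else 0) + (if G.b e = v then O.ηb e else 0)) • f e = 0

/-- Degree of a vertex in the subgraph with edge set `S` (a loop counts twice). -/
def deg [DecidableEq V] (G : SignedGraph V E) (S : Finset E) (v : V) : ℕ :=
  ∑ e ∈ S, ((if G.a e = v then 1 else 0) + (if G.b e = v then 1 else 0))

/-- Adjacency via an edge in the edge set `S`. -/
def AdjIn (G : SignedGraph V E) (S : Finset E) (v w : V) : Prop :=
  ∃ e ∈ S, (G.a e = v ∧ G.b e = w) ∨ (G.a e = w ∧ G.b e = v)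

/-- A circuit: a nonempty edge set forming a connected 2-regular subgraph. -/
def IsCircuit [DecidableEq V] (G : SignedGraph V E) (C : Finset E) : Prop :=
  C.Nonempty ∧
  (∀ v : V, (∃ e ∈ C, G.a e = v ∨ G.b e = v) → G.deg C v = 2) ∧
  (∀ v w : V, (∃ e ∈ C, G.a e = v ∨ G.b e = v) → (∃ e ∈ C, G.a e = w ∨ G.b e = w) →
     Relation.ReflTransGen (G.AdjIn C) v w)

/-- An unbalanced circuit: a circuit with an odd number of negative edges. -/
def IsUnbalancedCircuit [DecidableEq V] (G : SignedGraph V E) (C : Finset E) : Prop :=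
  G.IsCircuit C ∧ Odd (C.filter (fun e => G.sign e = -1)).card

/-- The subgraph with edge set `S` is balanced (contains no unbalanced circuit). -/
def BalancedOn [DecidableEq V] (G : SignedGraph V E) (S : Finset E) : Prop :=
  ∀ C : Finset E, C ⊆ S → ¬ G.IsUnbalancedCircuit C

/-- A balanced signed graph: contains no unbalanced circuit. -/
def Balanced [DecidableEq V] (G : SignedGraph V E) : Prop :=
  ∀ C : Finset E, ¬ G.IsUnbalancedCircuit C

/-- An unbalanced signed graph: contains an unbalanced circuit. -/
def Unbalanced [DecidableEq V] (G : SignedGraph V E) : Prop :=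
  ∃ C : Finset E, G.IsUnbalancedCircuit C

/-- Adjacency in the whole signed graph. -/
def Adj (G : SignedGraph V E) (v w : V) : Prop :=
  ∃ e : E, (G.a e = v ∧ G.b e = w) ∨ (G.a e = w ∧ G.b e = v)

/-- A connected signed graph: every two vertices are joined by a walk. -/
def Connected (G : SignedGraph V E) : Prop :=
  ∀ v w : V, Relation.ReflTransGen G.Adj v w

/-- The setoid on vertices whose classes are the connected components. -/
def compSetoid (G : SignedGraph V E) : Setoid V :=
  ⟨Relation.EqvGen G.Adj, Relation.EqvGen.is_equivalence _⟩

/-- The connected component of a vertex. -/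
def component (G : SignedGraph V E) (v : V) : Quotient G.compSetoid :=
  Quotient.mk G.compSetoid v

/-- The number of vertices of a connected component. -/
noncomputable def compN (G : SignedGraph V E) (q : Quotient G.compSetoid) : ℕ :=
  Nat.card {v : V // G.component v = q}

/-- The number of edges of a connected component. -/
noncomputable def compM (G : SignedGraph V E) (q : Quotient G.compSetoid) : ℕ :=
  Nat.card {e : E // G.component (G.a e) = q}

/-- The connected component `q` is unbalanced (contains an unbalanced circuit). -/
def CompUnbalanced [DecidableEq V] (G : SignedGraph V E) (q : Quotient G.compSetoid) : Prop :=
  ∃ C : Finset E, G.IsUnbalancedCircuit C ∧ ∃ e ∈ C, G.component (G.a e) = q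

open Classical in
/-- `β` of a connected component: `m - n` if unbalanced, `m - n + 1` if balanced. -/
noncomputable def compBeta [DecidableEq V] (G : SignedGraph V E)
    (q : Quotient G.compSetoid) : ℕ :=
  if G.CompUnbalanced q then G.compM q - G.compN q else G.compM q + 1 - G.compN q

/-- `β(G)`: the sum of `β(ω)` over the connected components `ω` of `G`. -/
noncomputable def beta [DecidableEq V] (G : SignedGraph V E) : ℕ :=
  ∑ᶠ q : Quotient G.compSetoid, G.compBeta q

/-- `κ(G)`: the number of unbalanced connected components of `G`. -/
noncomputable def kappa [DecidableEq V] (G : SignedGraph V E) : ℕ :=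
  Nat.card {q : Quotient G.compSetoid // G.CompUnbalanced q}

/-- The signed graph `G - F` obtained by deleting the edges in `F` (all vertices kept). -/
def delete [DecidableEq E] (G : SignedGraph V E) (F : Finset E) :
    SignedGraph V {e : E // e ∉ F} :=
  ⟨fun e => G.a e.1, fun e => G.b e.1, fun e => G.sign e.1, fun e => G.sign_unit e.1⟩

/-- The edges with both endpoints in `X` (the edge set of `G[X]`). -/
def insideEdges [Fintype E] [DecidableEq V] (G : SignedGraph V E) (X : Finset V) : Finset E :=
  Finset.univ.filter (fun e => G.a e ∈ X ∧ G.b e ∈ X)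

/-- The edges with one endpoint in `X` and one outside: `[X, Xᶜ]`. -/
def crossEdges [Fintype E] [DecidableEq V] (G : SignedGraph V E) (X : Finset V) : Finset E :=
  Finset.univ.filter (fun e => (G.a e ∈ X ∧ G.b e ∉ X) ∨ (G.a e ∉ X ∧ G.b e ∈ X))

/-- A cut: a nonempty set `B = [X, Xᶜ] ∪ E_X` where `X` is a nonempty vertex set and `E_X`
is a set of edges of `G[X]` minimal with `G[X] - E_X` balanced. -/
def IsCut [Fintype E] [DecidableEq V] [DecidableEq E]
    (G : SignedGraph V E) (B : Finset E) : Prop :=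
  B.Nonempty ∧ ∃ X : Finset V, X.Nonempty ∧ ∃ EX : Finset E,
    EX ⊆ G.insideEdges X ∧
    G.BalancedOn (G.insideEdges X \ EX) ∧
    (∀ EX' ⊆ EX, G.BalancedOn (G.insideEdges X \ EX') → EX' = EX) ∧
    B = G.crossEdges X ∪ EX

/-- A bond: a cut that is minimal (under inclusion) among cuts. -/
def IsBond [Fintype E] [DecidableEq V] [DecidableEq E]
    (G : SignedGraph V E) (B : Finset E) : Prop :=
  G.IsCut B ∧ ∀ B' ⊆ B, G.IsCut B' → B' = B

/-- A broken bond: a bond minus its largest edge (w.r.t. the linear order on `E`). -/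
def IsBrokenBond [Fintype E] [DecidableEq V] [LinearOrder E]
    (G : SignedGraph V E) (D : Finset E) : Prop :=
  ∃ B : Finset E, G.IsBond B ∧ ∃ h : B.Nonempty, D = B.erase (B.max' h)

/-- `F` contains no broken bond of `G` as a subset. -/
def NoBrokenBond [Fintype E] [DecidableEq V] [LinearOrder E]
    (G : SignedGraph V E) (F : Finset E) : Prop :=
  ∀ D : Finset E, G.IsBrokenBond D → ¬ D ⊆ F

end SignedGraph

/-- `ε(Γ)`: the largest `d` such that `Γ` has a subgroup isomorphic to `(ℤ/2ℤ)^d`. -/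
noncomputable def epsilon (Γ : Type) [AddCommGroup Γ] [Fintype Γ] : ℕ :=
  sSup {d : ℕ | ∃ H : AddSubgroup Γ, Nonempty (H ≃+ (Fin d → ZMod 2))}

theorem AddChar.map_sum_eq_prod {ι A M : Type*} [AddCommMonoid A] [CommMonoid M]
    (ψ : AddChar A M) (s : Finset ι) (f : ι → A) :
    ψ (∑ i ∈ s, f i) = ∏ i ∈ s, ψ (f i) := by
  classical
  induction s using Finset.induction_on with
  | empty => simp
  | insert i s hi ih => rw [Finset.sum_insert hi, Finset.prod_insert hi, ψ.map_add_eq_mul, ih]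

/-- Double counting by orthogonality of characters: the kernel of an integer matrix acting on
`E → Γ` and the kernel of its transpose acting on `V → Γ^` have proportional sizes. -/
theorem card_ker_mul_card_pow {V E Γ : Type*} [Fintype V] [Fintype E] [AddCommGroup Γ]
    [Fintype Γ] (M : V → E → ℤ) :
    Nat.card {f : E → Γ // ∀ v, ∑ e, M v e • f e = 0} * Fintype.card Γ ^ Fintype.card V =
      Fintype.card Γ ^ Fintype.card E *
        Nat.card {χ : V → AddChar Γ ℂ // ∀ e, ∑ v, M v e • χ v = 0} := by
  classical
  have key : ∑ f : E → Γ, ∑ χ : V → AddChar Γ ℂ, ∏ v, χ v (∑ e, M v e • f e) =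
      ∑ χ : V → AddChar Γ ℂ, ∑ f : E → Γ, ∏ e, (∑ v, M v e • χ v) (f e) := by
    rw [Finset.sum_comm]
    refine Finset.sum_congr rfl fun χ _ => Finset.sum_congr rfl fun f _ => ?_
    simp only [AddChar.map_sum_eq_prod, AddChar.sum_apply, AddChar.map_zsmul_eq_zpow,
      AddChar.zsmul_apply]
    exact Finset.prod_comm
  have hleft (f : E → Γ) : ∑ χ : V → AddChar Γ ℂ, ∏ v, χ v (∑ e, M v e • f e) =
      if ∀ v, ∑ e, M v e • f e = 0 then (Fintype.card Γ : ℂ) ^ Fintype.card V else 0 := by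
    have h := Finset.prod_univ_sum (fun _ : V => (Finset.univ : Finset (AddChar Γ ℂ)))
      (fun v ψ => ψ (∑ e, M v e • f e))
    rw [Fintype.piFinset_univ] at h
    rw [← h]
    simp only [AddChar.sum_apply_eq_ite]
    rw [Fintype.prod_ite_zero]
    simp
  have hright (χ : V → AddChar Γ ℂ) : ∑ f : E → Γ, ∏ e, (∑ v, M v e • χ v) (f e) =
      if ∀ e, ∑ v, M v e • χ v = 0 then (Fintype.card Γ : ℂ) ^ Fintype.card E else 0 := by
    have h := Finset.prod_univ_sum (fun _ : E => (Finset.univ : Finset Γ))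
      (fun e x => (∑ v, M v e • χ v) x)
    rw [Fintype.piFinset_univ] at h
    rw [← h]
    simp only [AddChar.sum_eq_ite]
    rw [Fintype.prod_ite_zero]
    simp
  simp only [hleft, hright, ← Finset.sum_filter, Finset.sum_const, nsmul_eq_mul] at key
  rw [Nat.card_eq_fintype_card, Nat.card_eq_fintype_card, Fintype.card_subtype,
    Fintype.card_subtype, mul_comm (_ ^ _)]
  exact_mod_cast key

/-- A finite abelian group and its dual have equally many elements of order at most two. -/
theorem card_two_torsion_addChar (Γ : Type*) [AddCommGroup Γ] [Fintype Γ] :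
    Nat.card {χ : AddChar Γ ℂ // 2 • χ = 0} = Nat.card {x : Γ // 2 • x = 0} := by
  have h := card_ker_mul_card_pow (Γ := Γ) (fun _ _ : Unit => 2)
  have e₁ : Nat.card {f : Unit → Γ // ∀ v : Unit, ∑ e : Unit, (2 : ℤ) • f e = 0} =
      Nat.card {x : Γ // 2 • x = 0} :=
    Nat.card_congr ((Equiv.funUnique Unit Γ).subtypeEquiv fun f => by
      simp [← natCast_zsmul])
  have e₂ : Nat.card {f : Unit → AddChar Γ ℂ // ∀ v : Unit, ∑ e : Unit, (2 : ℤ) • f e = 0} =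
      Nat.card {x : AddChar Γ ℂ // 2 • x = 0} :=
    Nat.card_congr ((Equiv.funUnique Unit (AddChar Γ ℂ)).subtypeEquiv fun f => by
      simp [← natCast_zsmul])
  rw [e₁, e₂, mul_comm] at h
  exact (Nat.eq_of_mul_eq_mul_left (pow_pos Fintype.card_pos _) h).symm

/-- The subgroup of elements of order at most two has order `2 ^ ε(Γ)`. -/
theorem card_two_torsion (Γ : Type) [AddCommGroup Γ] [Fintype Γ] :
    Nat.card {x : Γ // 2 • x = 0} = 2 ^ epsilon Γ := by
  classical
  let T : AddSubgroup Γ := (nsmulAddMonoidHom (α := Γ) 2).ker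
  have hT (x : Γ) : x ∈ T ↔ 2 • x = 0 := by simp [T, AddMonoidHom.mem_ker]
  have hcard : Nat.card {x : Γ // 2 • x = 0} = Nat.card T :=
    Nat.card_congr (Equiv.subtypeEquivRight fun x => (hT x).symm)
  let _ : Module (ZMod 2) T :=
    AddCommGroup.zmodModule fun x => Subtype.ext (by simpa using (hT x.1).1 x.2)
  let b := Module.finBasis (ZMod 2) T
  have hpow : Nat.card T = 2 ^ Module.finrank (ZMod 2) T := by
    rw [Nat.card_congr b.equivFun.toEquiv]
    simp
  have heps : epsilon Γ = Module.finrank (ZMod 2) T := by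
    refine IsGreatest.csSup_eq ⟨⟨T, ⟨b.equivFun.toAddEquiv⟩⟩, ?_⟩
    rintro d ⟨H, ⟨φ⟩⟩
    have hle : H ≤ T := fun x hx => (hT x).2 <| by
      have : 2 • (⟨x, hx⟩ : H) = 0 := φ.injective <| by
        rw [map_nsmul, map_zero]
        ext i
        simp [CharTwo.two_eq_zero]
      simpa using congrArg Subtype.val this
    have h : Nat.card H ≤ Nat.card T := Nat.card_le_card_of_injective _
      (AddSubgroup.inclusion_injective hle)
    rw [hpow, Nat.card_congr φ.toEquiv] at h
    exact (Nat.pow_le_pow_iff_right one_lt_two).1 (by simpa using h)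
  rw [hcard, hpow, heps]

namespace SignedGraph

variable {V E : Type}

/-- The edge `e` joins the vertices `v` and `w`. -/
def Joins (G : SignedGraph V E) (e : E) (v w : V) : Prop :=
  (G.a e = v ∧ G.b e = w) ∨ (G.a e = w ∧ G.b e = v)

/-- A step along an edge in the signed double cover: the second coordinate records the product
of the signs traversed so far. -/
def LiftStep (G : SignedGraph V E) (x y : V × ℤ) : Prop :=
  ∃ e, G.Joins e x.1 y.1 ∧ y.2 = x.2 * G.sign e

theorem sign_mul_self (G : SignedGraph V E) (e : E) : G.sign e * G.sign e = 1 := by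
  rcases G.sign_unit e with h | h <;> simp [h]

theorem Joins.symm {G : SignedGraph V E} {e : E} {v w : V} (h : G.Joins e v w) :
    G.Joins e w v := Or.symm h

theorem Joins.component_eq {G : SignedGraph V E} {e : E} {v w : V} (h : G.Joins e v w) :
    G.component v = G.component w :=
  Quotient.sound (Relation.EqvGen.rel _ _ ⟨e, h⟩)

theorem Joins.component_a {G : SignedGraph V E} {e : E} {v w : V} (h : G.Joins e v w) :
    G.component (G.a e) = G.component v := by
  rcases h with ⟨h, -⟩ | h
  · rw [h]
  · rw [h.1, ← Joins.component_eq (Or.inr h)]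

theorem component_b (G : SignedGraph V E) (e : E) :
    G.component (G.b e) = G.component (G.a e) :=
  (Joins.component_eq (e := e) (Or.inl ⟨rfl, rfl⟩)).symm

theorem LiftStep.symm {G : SignedGraph V E} {x y : V × ℤ} (h : G.LiftStep x y) :
    G.LiftStep y x := by
  obtain ⟨e, he, hs⟩ := h
  exact ⟨e, he.symm, by rw [hs, mul_assoc, G.sign_mul_self, mul_one]⟩

/-- Reachability in the signed double cover. -/
abbrev LiftReach (G : SignedGraph V E) : V × ℤ → V × ℤ → Prop :=
  Relation.ReflTransGen G.LiftStep

theorem LiftReach.symm {G : SignedGraph V E} {x y : V × ℤ} (h : G.LiftReach x y) :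
    G.LiftReach y x := by
  induction h with
  | refl => exact .refl
  | tail _ h ih => exact .head h.symm ih

theorem LiftReach.neg {G : SignedGraph V E} {x y : V × ℤ} (h : G.LiftReach x y) :
    G.LiftReach (x.1, -x.2) (y.1, -y.2) := by
  induction h with
  | refl => exact .refl
  | tail _ h ih =>
    obtain ⟨e, he, hs⟩ := h
    exact ih.tail ⟨e, he, by simp [hs]⟩

theorem LiftReach.component_eq {G : SignedGraph V E} {x y : V × ℤ} (h : G.LiftReach x y) :
    G.component x.1 = G.component y.1 := by
  induction h with
  | refl => rfl
  | tail _ h ih => exact ih.trans h.choose_spec.1.component_eq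

theorem LiftReach.unit {G : SignedGraph V E} {x y : V × ℤ} (h : G.LiftReach x y)
    (hx : x.2 = 1 ∨ x.2 = -1) : y.2 = 1 ∨ y.2 = -1 := by
  induction h with
  | refl => exact hx
  | tail _ h ih =>
    obtain ⟨e, -, hs⟩ := h
    rcases ih with h | h <;> rcases G.sign_unit e with h' | h' <;> simp [hs, h, h']

theorem exists_liftReach (G : SignedGraph V E) {v w : V} (h : G.component v = G.component w) :
    G.LiftReach (v, 1) (w, 1) ∨ G.LiftReach (v, 1) (w, -1) := by
  have hadj : Std.Symm G.Adj := ⟨fun _ _ ⟨e, he⟩ => ⟨e, Or.symm he⟩⟩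
  have h' : Relation.EqvGen G.Adj v w := Quotient.exact h
  rw [Relation.EqvGen.eqvGen_eq_reflTransGen] at h'
  clear h
  induction h' with
  | refl => exact .inl .refl
  | tail _ h ih =>
    obtain ⟨e, he⟩ := h
    rcases G.sign_unit e with hs | hs <;> rcases ih with ih | ih
    · exact .inl (ih.tail ⟨e, he, by simp [hs]⟩)
    · exact .inr (ih.tail ⟨e, he, by simp [hs]⟩)
    · exact .inr (ih.tail ⟨e, he, by simp [hs]⟩)
    · exact .inl (ih.tail ⟨e, he, by simp [hs]⟩)

/-- The base vertex of `q` is joined to itself by a closed walk of negative sign. -/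
def HasNegativeWalk (G : SignedGraph V E) (q : Quotient G.compSetoid) : Prop :=
  G.LiftReach (q.out, 1) (q.out, -1)

theorem component_out (G : SignedGraph V E) (q : Quotient G.compSetoid) :
    G.component q.out = q := Quotient.out_eq q

open Classical in
/-- The sign of a walk from the base vertex of the component of `v` to `v`. -/
noncomputable def walkSign (G : SignedGraph V E) (v : V) : ℤ :=
  if G.LiftReach ((G.component v).out, 1) (v, 1) then 1 else -1

theorem walkSign_unit (G : SignedGraph V E) (v : V) : G.walkSign v = 1 ∨ G.walkSign v = -1 := by
  unfold walkSign
  split_ifs <;> simp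

theorem liftReach_walkSign (G : SignedGraph V E) (v : V) :
    G.LiftReach ((G.component v).out, 1) (v, G.walkSign v) := by
  unfold walkSign
  split_ifs with h
  · exact h
  · exact (G.exists_liftReach (G.component_out _)).resolve_left h

theorem walkSign_switching (G : SignedGraph V E) {e : E}
    (h : ¬ G.HasNegativeWalk (G.component (G.a e))) :
    G.walkSign (G.a e) = G.sign e * G.walkSign (G.b e) := by
  have ha := G.liftReach_walkSign (G.a e)
  have hb := G.liftReach_walkSign (G.b e)
  rw [G.component_b] at hb
  have hab : G.LiftReach ((G.component (G.a e)).out, 1) (G.b e, G.walkSign (G.a e) * G.sign e) :=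
    ha.tail ⟨e, .inl ⟨rfl, rfl⟩, rfl⟩
  by_contra hne
  apply h
  have hneg : G.walkSign (G.a e) * G.sign e = -G.walkSign (G.b e) := by
    rcases G.walkSign_unit (G.a e) with h₁ | h₁ <;> rcases G.walkSign_unit (G.b e) with h₂ | h₂ <;>
      rcases G.sign_unit e with h₃ | h₃ <;> simp_all
  rw [hneg] at hab
  exact hb.trans (by simpa using LiftReach.symm (LiftReach.neg hab))

/-- A function satisfying the potential equations on a component transports along walks. -/
theorem LiftReach.smul_eq {G : SignedGraph V E} {A : Type*} [AddCommGroup A] {x y : V × ℤ}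
    (h : G.LiftReach x y) (z : V → A)
    (hz : ∀ e, G.component (G.a e) = G.component x.1 → z (G.a e) = G.sign e • z (G.b e)) :
    y.2 • z y.1 = x.2 • z x.1 := by
  induction h with
  | refl => rfl
  | @tail y w hxy h ih =>
    obtain ⟨e, he, hs⟩ := h
    have hze := hz e (he.component_a.trans (LiftReach.component_eq hxy).symm)
    rw [← ih, hs]
    rcases he with ⟨h₁, h₂⟩ | ⟨h₁, h₂⟩
    · rw [h₁, h₂] at hze
      rw [hze, smul_smul]
    · rw [h₁, h₂] at hze
      rw [hze, smul_smul, mul_assoc, G.sign_mul_self, mul_one]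

theorem eq_walkSign_smul (G : SignedGraph V E) {A : Type*} [AddCommGroup A]
    (z : V → A) (v : V)
    (hz : ∀ e, G.component (G.a e) = G.component v → z (G.a e) = G.sign e • z (G.b e)) :
    z v = G.walkSign v • z (G.component v).out := by
  have h := (G.liftReach_walkSign v).smul_eq z (by simpa only [G.component_out] using hz)
  simp only [one_smul] at h
  rw [← h, smul_smul]
  rcases G.walkSign_unit v with h | h <;> simp [h]

theorem two_nsmul_eq_zero_of_hasNegativeWalk (G : SignedGraph V E) {A : Type*} [AddCommGroup A]
    (z : V → A) {q : Quotient G.compSetoid} (hq : G.HasNegativeWalk q)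
    (hz : ∀ e, G.component (G.a e) = q → z (G.a e) = G.sign e • z (G.b e)) :
    2 • z q.out = 0 := by
  have h := LiftReach.smul_eq hq z (by simpa only [G.component_out] using hz)
  simp only [neg_smul, one_smul] at h
  rw [two_nsmul]
  nth_rewrite 1 [← h]
  simp

/-- Potentials are determined by their values at the base vertices, which are arbitrary on
components without negative closed walks and of order at most two on the others. -/
noncomputable def potentialEquiv (G : SignedGraph V E) (A : Type*) [AddCommGroup A] :
    {z : V → A // ∀ e, z (G.a e) = G.sign e • z (G.b e)} ≃
      ((q : Quotient G.compSetoid) → {x : A // G.HasNegativeWalk q → 2 • x = 0}) where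
  toFun z q := ⟨z.1 q.out, fun hq =>
    G.two_nsmul_eq_zero_of_hasNegativeWalk z.1 hq fun e _ => z.2 e⟩
  invFun y := ⟨fun v => G.walkSign v • (y (G.component v)).1, fun e => by
    beta_reduce
    rw [G.component_b, smul_smul]
    by_cases h : G.HasNegativeWalk (G.component (G.a e))
    · have h2 := (y (G.component (G.a e))).2 h
      rw [two_nsmul, ← eq_neg_iff_add_eq_zero] at h2
      rcases G.walkSign_unit (G.a e) with h₁ | h₁ <;>
        rcases G.walkSign_unit (G.b e) with h₂ | h₂ <;>
        rcases G.sign_unit e with h₃ | h₃ <;> simp [h₁, h₂, h₃, ← h2]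
    · rw [G.walkSign_switching h]⟩
  left_inv z := Subtype.ext <| funext fun v =>
    (G.eq_walkSign_smul z.1 v fun e _ => z.2 e).symm
  right_inv y := funext fun q => Subtype.ext <| by
    have hself : G.walkSign q.out = 1 := by
      rw [walkSign, if_pos]
      rw [G.component_out]
    simp only [hself, one_smul]
    rw [G.component_out]

theorem card_potential [Fintype V] (G : SignedGraph V E) (A : Type*) [AddCommGroup A] :
    Nat.card {z : V → A // ∀ e, z (G.a e) = G.sign e • z (G.b e)} =
      Nat.card {x : A // 2 • x = 0} ^ Nat.card {q // G.HasNegativeWalk q} *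
        Nat.card A ^ Nat.card {q // ¬ G.HasNegativeWalk q} := by
  classical
  have : Fintype (Quotient G.compSetoid) := Fintype.ofFinite _
  have hq (q : Quotient G.compSetoid) : Nat.card {x : A // G.HasNegativeWalk q → 2 • x = 0} =
      if G.HasNegativeWalk q then Nat.card {x : A // 2 • x = 0} else Nat.card A := by
    split_ifs with h
    · simp [h]
    · simp [h]
  rw [Nat.card_congr (G.potentialEquiv A), Nat.card_pi]
  simp only [hq, Finset.prod_ite, Finset.prod_const, Nat.card_eq_fintype_card,
    Fintype.card_subtype]

/-- Every component has at least as many edges as vertices, up to one if it has no negative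
closed walk. -/
theorem compN_le [Fintype V] [Fintype E] (G : SignedGraph V E) (q : Quotient G.compSetoid) :
    G.compN q ≤ G.compM q + 1 ∧ (G.HasNegativeWalk q → G.compN q ≤ G.compM q) := by
  classical
  let ext (y : {v // G.component v = q} → ZMod 3) (v : V) : ZMod 3 :=
    if h : G.component v = q then y ⟨v, h⟩ else 0
  let δ (y : {v // G.component v = q} → ZMod 3) (e : {e // G.component (G.a e) = q}) : ZMod 3 :=
    ext y (G.a e) - G.sign e • ext y (G.b e)
  have hsub (y y') (v : V) : ext (y - y') v = ext y v - ext y' v := by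
    by_cases h : G.component v = q <;> simp [ext, h]
  have hδ {y y'} (h : δ y = δ y') (e : E) (he : G.component (G.a e) = q) :
      ext (y - y') (G.a e) = G.sign e • ext (y - y') (G.b e) := by
    have h := congrFun h ⟨e, he⟩
    simp only [δ] at h
    rw [hsub, hsub, smul_sub]
    linear_combination h
  have hinj {y y'} (h : δ y = δ y') (h0 : ext (y - y') q.out = 0) : y = y' := by
    refine sub_eq_zero.1 (funext fun ⟨v, hv⟩ => ?_)
    have := G.eq_walkSign_smul (ext (y - y')) v (by rw [hv]; exact hδ h)
    rw [hv, h0, smul_zero] at this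
    simpa [ext, hv] using this
  constructor
  · have hf : Function.Injective fun y => (δ y, ext y q.out) := by
      intro y y' h
      simp only [Prod.mk.injEq] at h
      exact hinj h.1 (by rw [hsub, h.2, sub_self])
    have := Nat.card_le_card_of_injective _ hf
    simp only [Nat.card_prod, Nat.card_fun, Nat.card_zmod, ← pow_succ] at this
    exact (Nat.pow_le_pow_iff_right (by norm_num)).1 this
  · intro hq
    have hf : Function.Injective δ := by
      intro y y' h
      refine hinj h ?_
      have := G.two_nsmul_eq_zero_of_hasNegativeWalk _ hq (hδ h)
      generalize ext (y - y') q.out = t at this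
      revert t
      decide
    have := Nat.card_le_card_of_injective _ hf
    simp only [Nat.card_fun, Nat.card_zmod] at this
    exact (Nat.pow_le_pow_iff_right (by norm_num)).1 this

theorem prod_sign [DecidableEq E] (G : SignedGraph V E) (C : Finset E) :
    ∏ e ∈ C, G.sign e = (-1) ^ (C.filter (fun e => G.sign e = -1)).card := by
  rw [← Finset.prod_const, Finset.prod_filter]
  refine Finset.prod_congr rfl fun e _ => ?_
  rcases G.sign_unit e with h | h <;> simp [h]

theorem odd_card_negative_iff (G : SignedGraph V E) (C : Finset E) :
    Odd (C.filter (fun e => G.sign e = -1)).card ↔ ∏ e ∈ C, G.sign e = -1 := by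
  classical
  rw [G.prod_sign, neg_one_pow_eq_neg_one_iff_odd (by norm_num)]

theorem prod_endpoints_eq_prod_pow_deg [Fintype V] [DecidableEq V] (G : SignedGraph V E)
    (C : Finset E) (s : V → ℤ) :
    ∏ e ∈ C, s (G.a e) * s (G.b e) = ∏ v, s v ^ G.deg C v := by
  simp only [deg, ← Finset.prod_pow_eq_pow_sum]
  rw [Finset.prod_comm]
  refine Finset.prod_congr rfl fun e _ => ?_
  simp only [pow_add, Finset.prod_mul_distrib]
  simp

theorem IsCircuit.component_eq [DecidableEq V] {G : SignedGraph V E} {C : Finset E}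
    (hC : G.IsCircuit C) {e f : E} (he : e ∈ C) (hf : f ∈ C) :
    G.component (G.a e) = G.component (G.a f) := by
  have h := hC.2.2 (G.a e) (G.a f) ⟨e, he, .inl rfl⟩ ⟨f, hf, .inl rfl⟩
  generalize G.a f = w at h
  induction h with
  | refl => rfl
  | tail _ h ih =>
    obtain ⟨g, -, hg⟩ := h
    exact ih.trans (Joins.component_eq hg)

theorem hasNegativeWalk_of_compUnbalanced [Fintype V] [DecidableEq V] (G : SignedGraph V E)
    {q : Quotient G.compSetoid} (h : G.CompUnbalanced q) : G.HasNegativeWalk q := by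
  obtain ⟨C, ⟨hC, hodd⟩, e₀, he₀, rfl⟩ := h
  by_contra hneg
  rw [odd_card_negative_iff] at hodd
  have hsign : ∏ e ∈ C, G.sign e = ∏ e ∈ C, G.walkSign (G.a e) * G.walkSign (G.b e) := by
    refine Finset.prod_congr rfl fun e he => ?_
    rw [G.walkSign_switching (by rwa [hC.component_eq he he₀]), mul_assoc]
    rcases G.walkSign_unit (G.b e) with h | h <;> simp [h]
  rw [hsign, prod_endpoints_eq_prod_pow_deg, Finset.prod_eq_one] at hodd
  · norm_num at hodd
  · intro v _
    by_cases hv : ∃ e ∈ C, G.a e = v ∨ G.b e = v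
    · rw [hC.2.1 v hv]
      rcases G.walkSign_unit v with h | h <;> simp [h]
    · have : G.deg C v = 0 := by
        push Not at hv
        exact Finset.sum_eq_zero fun e he => by simp [hv e he]
      rw [this, pow_zero]

/-- `p 0, …, p l` is a walk in the signed double cover projecting to a closed walk of negative
sign. -/
structure IsNegativeWalk (G : SignedGraph V E) (q : Quotient G.compSetoid) (l : ℕ)
    (p : ℕ → V × ℤ) : Prop where
  step : ∀ i < l, G.LiftStep (p i) (p (i + 1))
  component : G.component (p 0).1 = q
  unit : (p 0).2 = 1 ∨ (p 0).2 = -1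
  closed : (p l).1 = (p 0).1
  neg : (p l).2 = -(p 0).2

theorem LiftReach.exists_walk {G : SignedGraph V E} {x y : V × ℤ} (h : G.LiftReach x y) :
    ∃ (l : ℕ) (p : ℕ → V × ℤ), p 0 = x ∧ p l = y ∧ ∀ i < l, G.LiftStep (p i) (p (i + 1)) := by
  induction h using Relation.ReflTransGen.head_induction_on with
  | refl => exact ⟨0, fun _ => y, rfl, rfl, by simp⟩
  | @head x z hxz _ ih =>
    obtain ⟨l, p, h0, hl, hp⟩ := ih
    refine ⟨l + 1, fun n => n.casesOn x p, rfl, hl, fun i hi => ?_⟩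
    cases i with
    | zero => simpa [h0] using hxz
    | succ i => exact hp i (by omega)

theorem IsNegativeWalk.reach {G : SignedGraph V E} {q : Quotient G.compSetoid} {l : ℕ}
    {p : ℕ → V × ℤ} (h : G.IsNegativeWalk q l p) {i : ℕ} (hi : i ≤ l) :
    G.LiftReach (p 0) (p i) := by
  induction i with
  | zero => exact .refl
  | succ i ih => exact (ih (by omega)).tail (h.step i (by omega))

/-- A shortest closed walk of negative sign does not repeat vertices. -/
theorem IsNegativeWalk.injOn_of_minimal {G : SignedGraph V E} {q : Quotient G.compSetoid} {l : ℕ}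
    {p : ℕ → V × ℤ} (h : G.IsNegativeWalk q l p)
    (hmin : ∀ m < l, ¬ ∃ p', G.IsNegativeWalk q m p') {i j : ℕ} (hij : i < j) (hj : j < l) :
    (p i).1 ≠ (p j).1 := by
  intro heq
  have hui := LiftReach.unit (h.reach (hij.le.trans hj.le)) h.unit
  have huj := LiftReach.unit (h.reach hj.le) h.unit
  by_cases hs : (p j).2 = (p i).2
  · have hp : p i = p j := Prod.ext heq hs.symm
    refine hmin (l - (j - i)) (by omega) ⟨fun n => if n ≤ i then p n else p (n + (j - i)), ?_⟩
    refine ⟨fun n hn => ?_, by simpa using h.component, by simpa using h.unit, ?_, ?_⟩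
    · rcases lt_trichotomy n i with hni | rfl | hni
      · simpa [hni.le, Nat.succ_le_of_lt hni] using h.step n (by omega)
      · have : n + 1 + (j - n) = j + 1 := by omega
        simpa [this, hp] using h.step j hj
      · have : n + 1 + (j - i) = n + (j - i) + 1 := by omega
        have h₂ : ¬ n + 1 ≤ i := by omega
        simpa only [if_neg hni.not_ge, if_neg h₂, this] using h.step (n + (j - i)) (by omega)
    all_goals
      have h₁ : ¬ l - (j - i) ≤ i := by omega
      have h₂ : l - (j - i) + (j - i) = l := by omega
      simp only [if_neg h₁, h₂, Nat.zero_le, if_true]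
    · exact h.closed
    · exact h.neg
  · have hj' : i + (j - i) = j := by omega
    refine hmin (j - i) (by omega) ⟨fun n => p (i + n), fun n hn => h.step _ (by omega), ?_, hui,
      ?_, ?_⟩
    · exact (LiftReach.component_eq (h.reach (hij.le.trans hj.le))).symm.trans h.component
    · simp only [hj', add_zero, heq]
    · simp only [hj', add_zero]
      omega

theorem compUnbalanced_of_hasNegativeWalk [DecidableEq V] (G : SignedGraph V E)
    {q : Quotient G.compSetoid} (hq : G.HasNegativeWalk q) : G.CompUnbalanced q := by
  classical
  have hex : ∃ l p, G.IsNegativeWalk q l p := by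
    obtain ⟨l, p, h0, hl, hp⟩ := LiftReach.exists_walk hq
    exact ⟨l, p, hp, by rw [h0, G.component_out], by simp [h0], by simp [h0, hl],
      by simp [h0, hl]⟩
  obtain ⟨l, ⟨p, hp⟩, hmin⟩ : ∃ l, (∃ p, G.IsNegativeWalk q l p) ∧
      ∀ m < l, ¬ ∃ p', G.IsNegativeWalk q m p' :=
    ⟨Nat.find hex, Nat.find_spec hex, fun m hm => Nat.find_min hex hm⟩
  have hl : l ≠ 0 := by
    rintro rfl
    have h₁ := hp.unit
    have h₂ := hp.neg
    omega
  have hV {i j : ℕ} (hi : i < l) (hj : j < l) (hij : (p i).1 = (p j).1) : i = j := by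
    rcases lt_trichotomy i j with h | h | h
    · exact absurd hij (hp.injOn_of_minimal hmin h hj)
    · exact h
    · exact absurd hij.symm (hp.injOn_of_minimal hmin h hi)
  have : Nonempty E := ⟨(hp.step 0 (by omega)).choose⟩
  have hstep : ∀ i, ∃ e, i < l → G.Joins e (p i).1 (p (i + 1)).1 ∧
      (p (i + 1)).2 = (p i).2 * G.sign e := by
    intro i
    by_cases hi : i < l
    · obtain ⟨e, he⟩ := hp.step i hi
      exact ⟨e, fun _ => he⟩
    · exact ⟨Classical.arbitrary E, fun h => absurd h hi⟩
  choose e he using hstep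
  have hprod (i : ℕ) (hi : i ≤ l) : (p i).2 = (p 0).2 * ∏ j ∈ Finset.range i, G.sign (e j) := by
    induction i with
    | zero => simp
    | succ i ih => rw [(he i hi).2, ih (by omega), Finset.prod_range_succ, mul_assoc]
  have hneg : ∏ j ∈ Finset.range l, G.sign (e j) = -1 := by
    have h := hprod l le_rfl
    rw [hp.neg] at h
    rcases hp.unit with h' | h' <;> rw [h'] at h <;> linarith
  have hlast {i : ℕ} (hi : i < l) {j : ℕ} (hj : j < l) (h : (p i).1 = (p (j + 1)).1) :
      i = j + 1 ∨ (i = 0 ∧ j + 1 = l) := by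
    rcases (show j + 1 < l ∨ j + 1 = l by omega) with h' | h'
    · exact .inl (hV hi h' h)
    · rw [h', hp.closed] at h
      exact .inr ⟨hV hi (by omega) h, h'⟩
  have hE' {i j : ℕ} (hij : i < j) (hj : j < l) : e i ≠ e j := by
    intro heq
    have h₁ := (he i (by omega)).1
    have h₂ := (he j hj).1
    rw [heq] at h₁
    have hne := hp.injOn_of_minimal hmin hij hj
    have h₃ : (p i).1 = (p (j + 1)).1 ∧ (p (i + 1)).1 = (p j).1 := by
      rcases h₁ with h₁ | h₁ <;> rcases h₂ with h₂ | h₂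
      · exact absurd (h₁.1.symm.trans h₂.1) hne
      · exact ⟨h₁.1.symm.trans h₂.1, h₁.2.symm.trans h₂.2⟩
      · exact ⟨h₁.2.symm.trans h₂.2, h₁.1.symm.trans h₂.1⟩
      · exact absurd (h₁.2.symm.trans h₂.2) hne
    have h₄ := hlast (hij.trans hj) hj h₃.1
    have h₅ := hlast hj (hij.trans hj) h₃.2.symm
    obtain ⟨rfl, rfl, rfl⟩ : i = 0 ∧ j = 1 ∧ l = 2 := by omega
    simp [Finset.prod_range_succ, heq, G.sign_mul_self] at hneg
  have hE : Set.InjOn e (Finset.range l : Set ℕ) := by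
    intro i hi j hj hij
    simp only [Finset.coe_range, Set.mem_Iio] at hi hj
    rcases lt_trichotomy i j with h | h | h
    · exact absurd hij (hE' h hj)
    · exact h
    · exact absurd hij.symm (hE' h hi)
  set C := (Finset.range l).image e with hC
  have hmem {i : ℕ} (hi : i < l) : e i ∈ C := Finset.mem_image_of_mem _ (by simpa using hi)
  have hvert (v : V) (hv : ∃ f ∈ C, G.a f = v ∨ G.b f = v) : ∃ i < l, (p i).1 = v := by
    obtain ⟨f, hf, hv⟩ := hv
    obtain ⟨i, hi, rfl⟩ := Finset.mem_image.1 hf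
    simp only [Finset.mem_range] at hi
    have : (p i).1 = v ∨ (p (i + 1)).1 = v := by
      rcases (he i hi).1 with ⟨h₁, h₂⟩ | ⟨h₁, h₂⟩ <;> rw [← h₁, ← h₂] <;> tauto
    rcases this with h | h
    · exact ⟨i, hi, h⟩
    · rcases (show i + 1 < l ∨ i + 1 = l by omega) with h' | h'
      · exact ⟨i + 1, h', h⟩
      · exact ⟨0, by omega, by rw [← h, h', hp.closed]⟩
  have hdeg (i : ℕ) (hi : i < l) : G.deg C (p i).1 = 2 := by
    have hone : ∑ j ∈ Finset.range l, (if (p j).1 = (p i).1 then 1 else 0) = 1 := by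
      rw [Finset.sum_eq_single_of_mem i (by simpa using hi), if_pos rfl]
      intro j hj hji
      rw [if_neg fun h => hji (hV (by simpa using hj) hi h)]
    have hshift : ∑ j ∈ Finset.range l, (if (p (j + 1)).1 = (p i).1 then 1 else 0) = 1 := by
      have h₁ := Finset.sum_range_succ (fun j => if (p j).1 = (p i).1 then 1 else 0) l
      rw [Finset.sum_range_succ', hone, hp.closed] at h₁
      omega
    rw [deg, hC, Finset.sum_image hE]
    calc _ = ∑ j ∈ Finset.range l, ((if (p j).1 = (p i).1 then 1 else 0) +
          (if (p (j + 1)).1 = (p i).1 then 1 else 0)) := by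
          refine Finset.sum_congr rfl fun j hj => ?_
          rcases (he j (by simpa using hj)).1 with ⟨h₁, h₂⟩ | ⟨h₁, h₂⟩ <;> rw [h₁, h₂]
          rw [add_comm]
      _ = 2 := by rw [Finset.sum_add_distrib, hone, hshift]
  have hreach (i : ℕ) (hi : i < l) : Relation.ReflTransGen (G.AdjIn C) (p 0).1 (p i).1 ∧
      Relation.ReflTransGen (G.AdjIn C) (p i).1 (p 0).1 := by
    induction i with
    | zero => exact ⟨.refl, .refl⟩
    | succ i ih =>
      have hi' : i < l := by omega
      exact ⟨(ih hi').1.tail ⟨e i, hmem hi', (he i hi').1⟩,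
        (ih hi').2.head ⟨e i, hmem hi', (he i hi').1.symm⟩⟩
  have hl0 : 0 < l := by omega
  refine ⟨C, ⟨⟨⟨e 0, hmem hl0⟩, fun v hv => ?_, fun v w hv hw => ?_⟩, ?_⟩, e 0, hmem hl0, ?_⟩
  · obtain ⟨i, hi, rfl⟩ := hvert v hv
    exact hdeg i hi
  · obtain ⟨i, hi, rfl⟩ := hvert v hv
    obtain ⟨j, hj, rfl⟩ := hvert w hw
    exact (hreach i hi).2.trans (hreach j hj).1
  · rw [odd_card_negative_iff, hC, Finset.prod_image hE, hneg]
  · rw [(he 0 hl0).1.component_a, hp.component]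

theorem hasNegativeWalk_iff_compUnbalanced [Fintype V] [DecidableEq V] (G : SignedGraph V E)
    (q : Quotient G.compSetoid) : G.HasNegativeWalk q ↔ G.CompUnbalanced q :=
  ⟨G.compUnbalanced_of_hasNegativeWalk, G.hasNegativeWalk_of_compUnbalanced⟩

theorem card_add_beta [Fintype V] [DecidableEq V] [Fintype E] (G : SignedGraph V E) :
    Fintype.card V + G.beta =
      Fintype.card E + Nat.card {q : Quotient G.compSetoid // ¬ G.CompUnbalanced q} := by
  classical
  have : Fintype (Quotient G.compSetoid) := Fintype.ofFinite _
  have hV : Fintype.card V = ∑ q, G.compN q := by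
    simp only [compN, Nat.card_eq_fintype_card, ← Fintype.card_sigma]
    exact Fintype.card_congr (Equiv.sigmaFiberEquiv G.component).symm
  have hE : Fintype.card E = ∑ q, G.compM q := by
    simp only [compM, Nat.card_eq_fintype_card, ← Fintype.card_sigma]
    exact Fintype.card_congr (Equiv.sigmaFiberEquiv fun e => G.component (G.a e)).symm
  rw [hV, hE, beta, finsum_eq_sum_of_fintype, Nat.card_eq_fintype_card, Fintype.card_subtype,
    Finset.card_filter, ← Finset.sum_add_distrib, ← Finset.sum_add_distrib]
  refine Finset.sum_congr rfl fun q _ => ?_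
  have h := G.compN_le q
  rw [hasNegativeWalk_iff_compUnbalanced] at h
  rw [compBeta]
  by_cases hq : G.CompUnbalanced q
  · have := h.2 hq
    simp only [hq, if_true, not_true, if_false]
    omega
  · simp only [hq, if_false, not_false_iff, if_true]
    omega

theorem Orientation.sum_incidence_smul_eq_zero_iff [Fintype V] [DecidableEq V]
    {G : SignedGraph V E} (O : G.Orientation) {A : Type*} [AddCommGroup A] (z : V → A) (e : E) :
    ∑ v, ((if G.a e = v then O.ηa e else 0) + (if G.b e = v then O.ηb e else 0)) • z v = 0 ↔
      z (G.a e) = G.sign e • z (G.b e) := by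
  have h := O.compat e
  simp only [add_smul, ite_smul, zero_smul, Finset.sum_add_distrib, Finset.sum_ite_eq,
    Finset.mem_univ, if_true]
  rcases O.ηa_unit e with ha | ha <;> rcases O.ηb_unit e with hb | hb <;> rw [ha, hb] at h ⊢
  · rw [show G.sign e = -1 by linarith, one_smul, one_smul, neg_one_zsmul, eq_neg_iff_add_eq_zero]
  · rw [show G.sign e = 1 by linarith, one_smul, one_smul, neg_one_zsmul, ← sub_eq_add_neg,
      sub_eq_zero]
  · rw [show G.sign e = 1 by linarith, neg_one_zsmul, one_zsmul, neg_add_eq_zero]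
  · rw [show G.sign e = -1 by linarith, neg_one_zsmul, neg_one_zsmul, eq_neg_iff_add_eq_zero,
      ← neg_add, neg_eq_zero]

end SignedGraph

/-- For a signed graph `G` with a fixed orientation and a finite abelian
group `Γ` of order `k`, the number of `Γ`-flows (not necessarily nowhere-zero) in `G` is
`2 ^ (κ(G) · ε(Γ)) · k ^ β(G)`. -/
theorem flow_count {V E : Type} [Fintype V] [DecidableEq V] [Fintype E]
    (G : SignedGraph V E) (O : G.Orientation)
    (Γ : Type) [AddCommGroup Γ] [Fintype Γ] (k : ℕ) (hk : Fintype.card Γ = k) :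
    Nat.card {f : E → Γ // G.IsFlow O f} = 2 ^ (G.kappa * epsilon Γ) * k ^ G.beta := by
  have hker := card_ker_mul_card_pow (Γ := Γ)
    (fun v e => (if G.a e = v then O.ηa e else 0) + (if G.b e = v then O.ηb e else 0))
  simp only [O.sum_incidence_smul_eq_zero_iff, G.card_potential,
    G.hasNegativeWalk_iff_compUnbalanced, Nat.card_eq_fintype_card (α := AddChar Γ ℂ),
    AddChar.card_eq, hk, card_two_torsion_addChar] at hker
  rw [card_two_torsion] at hker
  have hkpos : 0 < k := hk ▸ Fintype.card_pos
  refine Nat.eq_of_mul_eq_mul_right (pow_pos hkpos (Fintype.card V)) (hker.trans ?_)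
  rw [mul_assoc, ← pow_add, add_comm G.beta, G.card_add_beta, pow_add, SignedGraph.kappa,
    mul_comm _ (epsilon Γ), pow_mul]
  ring
end

section
/- Let G be a connected unbalanced signed graph with n vertices and m edges, let E_N be its set of negative edges, and assume G − E_N is connected. Fix e₀ ∈ E_N and fix an orientation of G in which e₀ is extroverted and every negative edge other than e₀ is introverted (positive edges oriented arbitrarily). Let Γ be a finite additive abelian group of order k. Then: (i) for every Γ-flow f in G, the element γ(f) := f(e₀) − Σ_{e ∈ E_N∖{e₀}} f(e) satisfies 2·γ(f) = 0; and (ii) for every γ ∈ Γ with 2γ = 0, the number of Γ-flows f in G with γ(f) = γ is exactly k^{m−n}. Consequently the total number of Γ-flows in G is 2^{ε(Γ)}·k^{m−n}. -/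
section

open Finset

namespace SignedGraph

variable {V E Γ : Type} [AddCommGroup Γ]

theorem Orientation.ηa_add_ηb_of_pos {G : SignedGraph V E} (O : G.Orientation) {e : E}
    (he : G.sign e ≠ -1) : O.ηa e + O.ηb e = 0 := by
  have hs := (G.sign_unit e).resolve_right he
  have h := O.compat e
  rcases O.ηa_unit e with h1 | h1 <;> rw [h1, hs] at h <;> rw [h1] <;> linarith

/-- The homomorphism sending a function `f` on the edges to
`f e₀ - ∑ e ∈ F \ {e₀}, f e`. -/
def excess [DecidableEq E] (F : Finset E) (e₀ : E) (Γ : Type) [AddCommGroup Γ] :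
    (E → Γ) →+ Γ where
  toFun f := f e₀ - ∑ e ∈ F.erase e₀, f e
  map_zero' := by simp
  map_add' f g := by simp only [Pi.add_apply, sum_add_distrib]; abel

theorem excess_apply [DecidableEq E] (F : Finset E) (e₀ : E) (f : E → Γ) :
    excess F e₀ Γ f = f e₀ - ∑ e ∈ F.erase e₀, f e := rfl

variable [Fintype E] [DecidableEq V]

/-- The boundary homomorphism of an oriented signed graph: its value at a vertex is the net
flow there, so the flows are its kernel. -/
def boundary (G : SignedGraph V E) (O : G.Orientation) (Γ : Type) [AddCommGroup Γ] :
    (E → Γ) →+ (V → Γ) where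
  toFun f v := ∑ e : E,
    ((if G.a e = v then O.ηa e else 0) + (if G.b e = v then O.ηb e else 0)) • f e
  map_zero' := by ext v; simp
  map_add' f g := by ext v; simp [smul_add, sum_add_distrib]

theorem boundary_apply (G : SignedGraph V E) (O : G.Orientation) (f : E → Γ) (v : V) :
    G.boundary O Γ f v = ∑ e : E,
      ((if G.a e = v then O.ηa e else 0) + (if G.b e = v then O.ηb e else 0)) • f e := rfl

theorem isFlow_iff_boundary_eq_zero (G : SignedGraph V E) (O : G.Orientation) (f : E → Γ) :
    G.IsFlow O f ↔ G.boundary O Γ f = 0 := by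
  rw [funext_iff]
  rfl

theorem boundary_single [DecidableEq E] (G : SignedGraph V E) (O : G.Orientation) (e : E) (x : Γ) :
    G.boundary O Γ (Pi.single e x) =
      Pi.single (G.a e) (O.ηa e • x) + Pi.single (G.b e) (O.ηb e • x) := by
  ext v
  rw [boundary_apply, sum_eq_single e]
  · simp only [Pi.single_eq_same, Pi.add_apply, Pi.single_apply, add_smul, ite_smul, zero_smul,
      @eq_comm _ v]
  · intro e' _ he'
    simp [Pi.single_eq_of_ne he']
  · simp

theorem sum_boundary [Fintype V] (G : SignedGraph V E) (O : G.Orientation) (f : E → Γ) :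
    ∑ v, G.boundary O Γ f v = ∑ e, (O.ηa e + O.ηb e) • f e := by
  simp only [boundary_apply]
  rw [sum_comm]
  refine sum_congr rfl fun e _ => ?_
  rw [← sum_smul, sum_add_distrib]
  simp

theorem exists_boundary_eq_single_sub_single [DecidableEq E] (G : SignedGraph V E)
    (O : G.Orientation) {F : Finset E} (hF : ∀ e ∉ F, G.sign e ≠ -1) {v w : V}
    (h : Relation.ReflTransGen (G.delete F).Adj v w) (x : Γ) :
    ∃ f : E → Γ, (∀ e ∈ F, f e = 0) ∧
      G.boundary O Γ f = Pi.single v x - Pi.single w x := by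
  induction h with
  | refl => exact ⟨0, by simp, by simp⟩
  | @tail u w _ hstep ih =>
    obtain ⟨f, hf, hfb⟩ := ih
    suffices ∃ g : E → Γ, (∀ e ∈ F, g e = 0) ∧
        G.boundary O Γ g = Pi.single u x - Pi.single w x by
      obtain ⟨g, hg, hgb⟩ := this
      refine ⟨f + g, fun e he => by simp [hf e he, hg e he], ?_⟩
      rw [map_add, hfb, hgb]
      abel
    obtain ⟨⟨e, he⟩, hends⟩ := hstep
    have hsum := O.ηa_add_ηb_of_pos (hF e he)
    have hsupp (y : Γ) : ∀ e' ∈ F, (Pi.single e y : E → Γ) e' = 0 := fun e' he' =>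
      Pi.single_eq_of_ne (ne_of_mem_of_not_mem he' he) _
    have hb : O.ηb e = -O.ηa e := by linarith
    have hsq : O.ηa e * O.ηa e = 1 := by rcases O.ηa_unit e with h | h <;> simp [h]
    rcases hends with ⟨h1, h2⟩ | ⟨h1, h2⟩ <;> simp only [delete] at h1 h2 <;> subst h1 h2
    · refine ⟨Pi.single e (O.ηa e • x), hsupp _, ?_⟩
      rw [boundary_single, hb, neg_smul, smul_smul, hsq, one_smul, Pi.single_neg, sub_eq_add_neg]
    · refine ⟨Pi.single e (-(O.ηa e • x)), hsupp _, ?_⟩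
      rw [boundary_single, hb, smul_neg, neg_smul, smul_neg, neg_neg, smul_smul, hsq, one_smul,
        Pi.single_neg]
      abel

theorem exists_boundary_eq_of_sum_eq_zero [Fintype V] [DecidableEq E] (G : SignedGraph V E)
    (O : G.Orientation) {F : Finset E} (hF : ∀ e ∉ F, G.sign e ≠ -1)
    (hconn : (G.delete F).Connected) (d : V → Γ) (hd : ∑ v, d v = 0) :
    ∃ f : E → Γ, (∀ e ∈ F, f e = 0) ∧ G.boundary O Γ f = d := by
  rcases isEmpty_or_nonempty V with _ | ⟨⟨r⟩⟩
  · exact ⟨0, by simp, Subsingleton.elim _ _⟩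
  choose f hf hfb using fun v =>
    G.exists_boundary_eq_single_sub_single O hF (hconn v r) (d v)
  refine ⟨∑ v, f v, fun e he => by simp [hf _ e he], ?_⟩
  have hr : ∑ v, (Pi.single r (d v) : V → Γ) = 0 := by
    exact (map_sum (AddMonoidHom.single (fun _ : V => Γ) r) d univ).symm.trans (by
      rw [hd, map_zero])
  rw [map_sum, sum_congr rfl fun v _ => hfb v, sum_sub_distrib, univ_sum_single, hr, sub_zero]

section Excess

variable [Fintype V] [DecidableEq E] {G : SignedGraph V E} {O : G.Orientation} {F : Finset E}
  {e₀ : E}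

theorem sum_boundary_eq_excess_add_excess (hF : ∀ e ∉ F, G.sign e ≠ -1) (he₀ : e₀ ∈ F)
    (hext : O.ηa e₀ = 1 ∧ O.ηb e₀ = 1)
    (hintro : ∀ e ∈ F, e ≠ e₀ → O.ηa e = -1 ∧ O.ηb e = -1) (f : E → Γ) :
    ∑ v, G.boundary O Γ f v = excess F e₀ Γ f + excess F e₀ Γ f := by
  rw [sum_boundary, ← sum_subset (subset_univ F) fun e _ he => by
    rw [O.ηa_add_ηb_of_pos (hF e he), zero_smul], ← add_sum_erase _ _ he₀, hext.1, hext.2,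
    excess_apply]
  have : ∀ e ∈ F.erase e₀, (O.ηa e + O.ηb e) • f e = -(f e + f e) := by
    intro e he
    obtain ⟨h1, h2⟩ := hintro e (mem_of_mem_erase he) (ne_of_mem_erase he)
    rw [h1, h2, add_smul, neg_one_smul]
    abel
  rw [sum_congr rfl this, sum_neg_distrib, sum_add_distrib, add_smul, one_smul]
  abel

theorem exists_boundary_eq_and_excess_eq (hF : ∀ e ∉ F, G.sign e ≠ -1)
    (hconn : (G.delete F).Connected) (he₀ : e₀ ∈ F) (hext : O.ηa e₀ = 1 ∧ O.ηb e₀ = 1)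
    (hintro : ∀ e ∈ F, e ≠ e₀ → O.ηa e = -1 ∧ O.ηb e = -1) {d : V → Γ} {g : Γ}
    (hdg : ∑ v, d v = g + g) :
    ∃ f : E → Γ, G.boundary O Γ f = d ∧ excess F e₀ Γ f = g := by
  have hg : excess F e₀ Γ (Pi.single e₀ g) = g := by
    rw [excess_apply, Pi.single_eq_same, sum_eq_zero fun e he =>
      Pi.single_eq_of_ne (ne_of_mem_erase he) _, sub_zero]
  obtain ⟨f, hf, hfb⟩ := G.exists_boundary_eq_of_sum_eq_zero O hF hconn
    (d - G.boundary O Γ (Pi.single e₀ g)) (by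
      simp only [Pi.sub_apply, sum_sub_distrib]
      rw [sum_boundary_eq_excess_add_excess hF he₀ hext hintro, hg, hdg, sub_self])
  refine ⟨f + Pi.single e₀ g, by rw [map_add, hfb, sub_add_cancel], ?_⟩
  have : excess F e₀ Γ f = 0 := by
    rw [excess_apply, hf e₀ he₀, sum_eq_zero fun e he => hf e (mem_of_mem_erase he), sub_zero]
  rw [map_add, this, hg, zero_add]

end Excess

end SignedGraph

theorem AddMonoidHom.card_fiber_eq_card_ker {A B : Type*} [AddGroup A] [AddGroup B] (φ : A →+ B)
    (a : A) : Nat.card {x // φ x = φ a} = Nat.card φ.ker :=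
  Nat.card_congr <| (Equiv.subRight a).subtypeEquiv fun x => by
    simp [AddMonoidHom.mem_ker, sub_eq_zero]

theorem AddMonoidHom.card_ker_mul_card_range {A B : Type*} [AddGroup A] [AddGroup B] (φ : A →+ B) :
    Nat.card φ.ker * Nat.card φ.range = Nat.card A := by
  rw [← AddSubgroup.index_ker, AddSubgroup.card_mul_index]

/-- The pairs `(d, g)` with `∑ v, d v = g + g` make up a subgroup of index `card Γ`. -/
theorem card_ker_sum_sub_double {V Γ : Type} [Fintype V] [Nonempty V] [DecidableEq V]
    [AddCommGroup Γ] [Fintype Γ] (ψ : (V → Γ) × Γ →+ Γ)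
    (hψ : ∀ p, ψ p = ∑ v, p.1 v - (p.2 + p.2)) :
    Nat.card ψ.ker = Fintype.card Γ ^ Fintype.card V := by
  have hsurj : ψ.range = ⊤ := by
    refine AddMonoidHom.range_eq_top.2 fun x => ?_
    obtain ⟨r⟩ := ‹Nonempty V›
    exact ⟨(Pi.single r x, 0), by simp [hψ]⟩
  have h := ψ.card_ker_mul_card_range
  rw [hsurj, AddSubgroup.card_top, Nat.card_prod] at h
  rw [Nat.eq_of_mul_eq_mul_right Nat.card_pos h, Nat.card_fun, Nat.card_eq_fintype_card,
    Nat.card_eq_fintype_card]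

theorem SignedGraph.card_boundary_eq_zero_and_excess_eq {V E Γ : Type} [Fintype V] [DecidableEq V]
    [Fintype E] [DecidableEq E] [AddCommGroup Γ] [Fintype Γ] {G : SignedGraph V E}
    {O : G.Orientation} {F : Finset E} {e₀ : E} (hF : ∀ e ∉ F, G.sign e ≠ -1)
    (hconn : (G.delete F).Connected) (he₀ : e₀ ∈ F) (hext : O.ηa e₀ = 1 ∧ O.ηb e₀ = 1)
    (hintro : ∀ e ∈ F, e ≠ e₀ → O.ηa e = -1 ∧ O.ηb e = -1) {g : Γ} (hg : g + g = 0) :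
    Nat.card {f : E → Γ // G.boundary O Γ f = 0 ∧ excess F e₀ Γ f = g} =
      Fintype.card Γ ^ (Fintype.card E - Fintype.card V) := by
  have : Nonempty V := ⟨G.a e₀⟩
  let φ : (E → Γ) →+ (V → Γ) × Γ := (G.boundary O Γ).prod (excess F e₀ Γ)
  let ψ : (V → Γ) × Γ →+ Γ :=
    { toFun := fun p => ∑ v, p.1 v - (p.2 + p.2)
      map_zero' := by simp
      map_add' := fun p q => by
        simp only [Prod.fst_add, Prod.snd_add, Pi.add_apply, sum_add_distrib]
        abel }
  have hrange : φ.range = ψ.ker := by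
    ext ⟨d, x⟩
    rw [AddMonoidHom.mem_ker, AddMonoidHom.mem_range]
    change (∃ f, (G.boundary O Γ f, excess F e₀ Γ f) = (d, x)) ↔ ∑ v, d v - (x + x) = 0
    simp only [Prod.mk.injEq, sub_eq_zero]
    constructor
    · rintro ⟨f, rfl, rfl⟩
      exact sum_boundary_eq_excess_add_excess hF he₀ hext hintro f
    · exact exists_boundary_eq_and_excess_eq hF hconn he₀ hext hintro
  obtain ⟨f₀, hf₀, hf₀g⟩ := exists_boundary_eq_and_excess_eq hF hconn he₀ hext hintro
    (d := 0) (g := g) (by simp [hg])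
  have hfiber := φ.card_fiber_eq_card_ker f₀
  have hmul := φ.card_ker_mul_card_range
  rw [hrange, card_ker_sum_sub_double ψ fun _ => rfl, Nat.card_fun,
    Nat.card_eq_fintype_card (α := Γ), Nat.card_eq_fintype_card (α := E)] at hmul
  have hφ (f : E → Γ) : φ f = φ f₀ ↔ G.boundary O Γ f = 0 ∧ excess F e₀ Γ f = g := by
    change (G.boundary O Γ f, excess F e₀ Γ f) = (G.boundary O Γ f₀, excess F e₀ Γ f₀) ↔ _
    rw [hf₀, hf₀g, Prod.mk.injEq]
  rw [← Nat.card_congr (Equiv.subtypeEquivRight hφ), hfiber]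
  have hpos : 0 < Fintype.card Γ := Fintype.card_pos
  rcases eq_or_lt_of_le (show 1 ≤ Fintype.card Γ from hpos) with h1 | h1
  · rw [← h1, one_pow, one_pow, mul_one] at hmul
    rw [hmul, ← h1, one_pow]
  · have hle : Fintype.card V ≤ Fintype.card E :=
      (Nat.pow_le_pow_iff_right h1).1 (Nat.le_of_dvd (pow_pos hpos _) ⟨_, by rw [← hmul, mul_comm]⟩)
    refine Nat.eq_of_mul_eq_mul_right (pow_pos hpos (Fintype.card V)) ?_
    rw [hmul, ← pow_add, Nat.sub_add_cancel hle]

theorem card_add_self_eq_zero (Γ : Type) [AddCommGroup Γ] [Fintype Γ] :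
    Nat.card {g : Γ // g + g = 0} = 2 ^ epsilon Γ := by
  let T : AddSubgroup Γ := (AddMonoidHom.id Γ + AddMonoidHom.id Γ).ker
  have hT (g : Γ) : g ∈ T ↔ g + g = 0 := Iff.rfl
  have hcard : Nat.card {g : Γ // g + g = 0} = Nat.card T := rfl
  let _ : Module (ZMod 2) T := AddCommGroup.zmodModule fun x => by
    rw [two_nsmul]
    exact Subtype.ext x.2
  have hpow (d : ℕ) : Nat.card (Fin d → ZMod 2) = 2 ^ d := by simp
  have e : T ≃+ (Fin (Module.finrank (ZMod 2) T) → ZMod 2) :=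
    (Module.finBasis (ZMod 2) T).equivFun.toAddEquiv
  have hTcard : Nat.card T = 2 ^ Module.finrank (ZMod 2) T := by
    rw [Nat.card_congr e.toEquiv, hpow]
  have hgreatest : IsGreatest {d : ℕ | ∃ H : AddSubgroup Γ, Nonempty (H ≃+ (Fin d → ZMod 2))}
      (Module.finrank (ZMod 2) T) := by
    refine ⟨⟨T, ⟨e⟩⟩, ?_⟩
    rintro d ⟨H, ⟨i⟩⟩
    have hle : H ≤ T := fun x hx => by
      have : (⟨x, hx⟩ + ⟨x, hx⟩ : H) = 0 := i.injective <| by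
        rw [map_add, map_zero]
        ext j
        exact CharTwo.add_self_eq_zero _
      exact congrArg Subtype.val this
    have hcardle := AddSubgroup.card_le_of_le hle
    rw [Nat.card_congr i.toEquiv, hpow, hTcard] at hcardle
    exact (Nat.pow_le_pow_iff_right one_lt_two).1 hcardle
  rw [hcard, hTcard, epsilon, hgreatest.csSup_eq]

end

/-- Let `G` be a connected unbalanced signed graph with negative edge set
`E_N` such that `G - E_N` is connected, oriented so that `e₀ ∈ E_N` is extroverted and all
other negative edges are introverted. For a finite abelian group `Γ` of order `k`:
(i) `γ(f) := f e₀ - ∑_{e ∈ E_N∖{e₀}} f e` satisfies `γ(f) + γ(f) = 0` for every `Γ`-flow `f`;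
(ii) for each `γ` with `γ + γ = 0`, exactly `k ^ (m - n)` flows `f` have `γ(f) = γ`;
and the total number of `Γ`-flows is `2 ^ ε(Γ) · k ^ (m - n)`. -/
theorem flows_classified {V E : Type} [Fintype V] [DecidableEq V] [Fintype E] [DecidableEq E]
    (G : SignedGraph V E) (O : G.Orientation)
    (hconn : G.Connected) (hunb : G.Unbalanced)
    (EN : Finset E) (hEN : EN = Finset.univ.filter (fun e => G.sign e = -1))
    (hconn' : (G.delete EN).Connected)
    (e₀ : E) (he₀ : e₀ ∈ EN)
    (hext : O.ηa e₀ = 1 ∧ O.ηb e₀ = 1)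
    (hintro : ∀ e ∈ EN, e ≠ e₀ → O.ηa e = -1 ∧ O.ηb e = -1)
    (Γ : Type) [AddCommGroup Γ] [Fintype Γ] (k : ℕ) (hk : Fintype.card Γ = k)
    (γof : (E → Γ) → Γ) (hγof : ∀ f, γof f = f e₀ - ∑ e ∈ EN.erase e₀, f e) :
    (∀ f : E → Γ, G.IsFlow O f → γof f + γof f = 0) ∧
    (∀ γ : Γ, γ + γ = 0 →
      Nat.card {f : E → Γ // G.IsFlow O f ∧ γof f = γ} =
        k ^ (Fintype.card E - Fintype.card V)) ∧
    Nat.card {f : E → Γ // G.IsFlow O f} =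
      2 ^ epsilon Γ * k ^ (Fintype.card E - Fintype.card V) := by
  obtain rfl : γof = SignedGraph.excess EN e₀ Γ := funext hγof
  subst hk
  have hpos : ∀ e ∉ EN, G.sign e ≠ -1 := fun e he h => he (by simp [hEN, h])
  have htwo (f : E → Γ) (hf : G.IsFlow O f) :
      SignedGraph.excess EN e₀ Γ f + SignedGraph.excess EN e₀ Γ f = 0 := by
    rw [← SignedGraph.sum_boundary_eq_excess_add_excess hpos he₀ hext hintro,
      (G.isFlow_iff_boundary_eq_zero O f).1 hf]
    simp
  have hfiber (γ : Γ) (hγ : γ + γ = 0) :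
      Nat.card {f : E → Γ // G.IsFlow O f ∧ SignedGraph.excess EN e₀ Γ f = γ} =
        Fintype.card Γ ^ (Fintype.card E - Fintype.card V) := by
    simp only [SignedGraph.isFlow_iff_boundary_eq_zero]
    exact SignedGraph.card_boundary_eq_zero_and_excess_eq hpos hconn' he₀ hext hintro hγ
  refine ⟨htwo, hfiber, ?_⟩
  let p : {f : E → Γ // G.IsFlow O f} → {g : Γ // g + g = 0} :=
    fun f => ⟨SignedGraph.excess EN e₀ Γ f, htwo f f.2⟩
  have hp (g : {g : Γ // g + g = 0}) : Nat.card {f // p f = g} =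
      Fintype.card Γ ^ (Fintype.card E - Fintype.card V) := by
    rw [← hfiber g g.2, ← Nat.card_congr (Equiv.subtypeSubtypeEquivSubtypeInter _ _)]
    exact Nat.card_congr (Equiv.subtypeEquivRight fun f => Subtype.ext_iff)
  classical
  rw [← Nat.card_congr (Equiv.sigmaFiberEquiv p), Nat.card_sigma, Finset.sum_congr rfl fun g _ => hp g,
    Finset.sum_const, Finset.card_univ, ← Nat.card_eq_fintype_card, card_add_self_eq_zero, smul_eq_mul]
end

section
/- Let G be a connected unbalanced signed graph with edge set E carrying a linear order ≺, and let F ⊆ E be a set of edges that contains no broken bond of G as a subset. Then every connected component of G − F is unbalanced. -/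
namespace SignedGraph

variable {V E : Type}

theorem deg_map_subtype_delete [DecidableEq V] [DecidableEq E] (G : SignedGraph V E)
    (F : Finset E) (C : Finset {e : E // e ∉ F}) (v : V) :
    G.deg (C.map (Function.Embedding.subtype _)) v = (G.delete F).deg C v := by
  simp [deg, delete]
  rfl

theorem adjIn_map_subtype_delete [DecidableEq E] (G : SignedGraph V E)
    (F : Finset E) (C : Finset {e : E // e ∉ F}) :
    G.AdjIn (C.map (Function.Embedding.subtype _)) = (G.delete F).AdjIn C := by
  ext v w
  simp only [AdjIn, delete, Finset.mem_map, Function.Embedding.subtype_apply]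
  constructor
  · rintro ⟨_, ⟨e, he, rfl⟩, h⟩
    exact ⟨e, he, h⟩
  · rintro ⟨e, he, h⟩
    exact ⟨e, ⟨e, he, rfl⟩, h⟩

theorem exists_incident_map_subtype_delete [DecidableEq E] (G : SignedGraph V E)
    (F : Finset E) (C : Finset {e : E // e ∉ F}) (v : V) :
    (∃ e ∈ C, (G.delete F).a e = v ∨ (G.delete F).b e = v) ↔
      ∃ e ∈ C.map (Function.Embedding.subtype _), G.a e = v ∨ G.b e = v := by
  simp only [delete, Finset.mem_map, Function.Embedding.subtype_apply]
  constructor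
  · rintro ⟨e, he, h⟩
    exact ⟨e, ⟨e, he, rfl⟩, h⟩
  · rintro ⟨_, ⟨e, he, rfl⟩, h⟩
    exact ⟨e, he, h⟩

/-- The unbalanced circuits of `G - F` are the unbalanced circuits of `G` avoiding `F`. -/
theorem isUnbalancedCircuit_delete_iff [DecidableEq V] [DecidableEq E] (G : SignedGraph V E)
    (F : Finset E) (C : Finset {e : E // e ∉ F}) :
    (G.delete F).IsUnbalancedCircuit C ↔
      G.IsUnbalancedCircuit (C.map (Function.Embedding.subtype _)) := by
  simp only [IsUnbalancedCircuit, IsCircuit, exists_incident_map_subtype_delete,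
    deg_map_subtype_delete, adjIn_map_subtype_delete, Finset.map_nonempty, Finset.filter_map,
    Finset.card_map]
  rfl

/-- Every set of edges of `G[X]` whose removal balances `G[X]` contains a minimal one. -/
theorem exists_minimal_balancing_subset [Fintype E] [DecidableEq V] [DecidableEq E]
    (G : SignedGraph V E) (X : Finset V) (S : Finset E)
    (hS : G.BalancedOn (G.insideEdges X \ S)) :
    ∃ T ⊆ S, G.BalancedOn (G.insideEdges X \ T) ∧
      ∀ T' ⊆ T, G.BalancedOn (G.insideEdges X \ T') → T' = T := by
  obtain ⟨T, hTS, hT⟩ := exists_minimal_le_of_wellFoundedLT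
    (fun T => G.BalancedOn (G.insideEdges X \ T)) S hS
  exact ⟨T, hTS, hT.prop, fun T' hT' h => hT.eq_of_le h hT'⟩

theorem IsCut.exists_isBond_subset [Fintype E] [DecidableEq V] [DecidableEq E]
    {G : SignedGraph V E} {B : Finset E} (hB : G.IsCut B) : ∃ B' ⊆ B, G.IsBond B' := by
  obtain ⟨B', hB', h⟩ := exists_minimal_le_of_wellFoundedLT G.IsCut B hB
  exact ⟨B', hB', h.prop, fun D hD hc => h.eq_of_le hc hD⟩

theorem NoBrokenBond.not_isCut_subset [Fintype E] [DecidableEq V] [LinearOrder E]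
    {G : SignedGraph V E} {F : Finset E} (hF : G.NoBrokenBond F) {B : Finset E}
    (hBF : B ⊆ F) : ¬ G.IsCut B := by
  intro hB
  obtain ⟨D, hDB, hD⟩ := hB.exists_isBond_subset
  exact hF _ ⟨D, hD, hD.1.1, rfl⟩ ((Finset.erase_subset _ _).trans (hDB.trans hBF))

theorem Connected.mem_of_crossEdges_eq_empty [Fintype E] [DecidableEq V]
    {G : SignedGraph V E} (hconn : G.Connected) {X : Finset V} (hX : X.Nonempty)
    (h : G.crossEdges X = ∅) (w : V) : w ∈ X := by
  obtain ⟨v, hv⟩ := hX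
  induction hconn v w with
  | refl => exact hv
  | tail _ hadj ih =>
    obtain ⟨e, he⟩ := hadj
    have hcross : e ∉ G.crossEdges X := by simp [h]
    simp only [crossEdges, Finset.mem_filter, Finset.mem_univ, true_and] at hcross
    obtain ⟨rfl, rfl⟩ | ⟨rfl, rfl⟩ := he <;> tauto

end SignedGraph

/-- If `G` is connected and unbalanced and `F ⊆ E` contains no broken
bond, then every connected component of `G - F` is unbalanced. -/
theorem components_unbalanced {V E : Type}
    [Fintype V] [DecidableEq V] [Fintype E] [LinearOrder E]
    (G : SignedGraph V E) (hconn : G.Connected) (hunb : G.Unbalanced)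
    (F : Finset E) (hF : G.NoBrokenBond F) :
    ∀ q : Quotient (G.delete F).compSetoid, (G.delete F).CompUnbalanced q := by
  classical
  intro q
  by_contra hq
  let X : Finset V := Finset.univ.filter fun v => (G.delete F).component v = q
  have mem_X (v : V) : v ∈ X ↔ (G.delete F).component v = q := by simp [X]
  have hX : X.Nonempty := by
    obtain ⟨v, hv⟩ := Quotient.exists_rep q
    exact ⟨v, (mem_X v).2 hv⟩
  have hcross : G.crossEdges X ⊆ F := by
    intro e he
    by_contra heF
    have hab : (G.delete F).component (G.a e) = (G.delete F).component (G.b e) :=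
      Quotient.sound (Relation.EqvGen.rel _ _ ⟨⟨e, heF⟩, Or.inl ⟨rfl, rfl⟩⟩)
    simp only [SignedGraph.crossEdges, Finset.mem_filter, Finset.mem_univ, true_and, mem_X,
      hab] at he
    tauto
  have hbal : G.BalancedOn (G.insideEdges X \ (G.insideEdges X ∩ F)) := by
    intro C hC hCunb
    have hCF : ∀ e ∈ C, e ∉ F := fun e he heF => by
      have := hC he
      simp_all
    rw [← Finset.subtype_map_of_mem hCF, ← SignedGraph.isUnbalancedCircuit_delete_iff] at hCunb
    obtain ⟨e, he⟩ := hCunb.1.1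
    refine hq ⟨_, hCunb, e, he, (mem_X _).1 ?_⟩
    have := hC (Finset.mem_subtype.1 he)
    simp only [SignedGraph.insideEdges, Finset.mem_sdiff, Finset.mem_filter] at this
    exact this.1.2.1
  obtain ⟨T, hTS, hT, hTmin⟩ := G.exists_minimal_balancing_subset X _ hbal
  have hTF : T ⊆ F := hTS.trans Finset.inter_subset_right
  refine hF.not_isCut_subset (Finset.union_subset hcross hTF)
    ⟨?_, X, hX, T, hTS.trans Finset.inter_subset_left, hT, hTmin, rfl⟩
  by_contra hempty
  rw [Finset.not_nonempty_iff_eq_empty, Finset.union_eq_empty] at hempty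
  have hall := hconn.mem_of_crossEdges_eq_empty hX hempty.1
  obtain ⟨C, hC⟩ := hunb
  refine hT C (fun e _ => ?_) hC
  simp [hempty.2, SignedGraph.insideEdges, hall]
end
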